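/- arXiv:1810.00993 — 2 statements merged into one kernel-verified Lean document; each statement's English description precedes it below -/
import Mathlib

section
/- For all n ≥ 1, the number of ballot permutations of {1,…,n} equals the number of odd order permutations of {1,…,n}, and both equal ((n−1)!!)² when n is even and n!!·(n−2)!! when n is odd, where (2m−1)!! = (2m−1)(2m−3)⋯3·1 and (2m)!! = (2m)(2m−2)⋯2. -/
open Finset
open scoped Classical

/-- The one-line word of a permutation of `Fin n`, with values in `{1, …, n}`. -/
def permWord {n : ℕ} (π : Equiv.Perm (Fin n)) : List ℕ :=
  (List.finRange n).map fun i => (π i : ℕ) + 1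

/-- The set of (0-indexed) ascent positions of a word. Position `i` (for
`0 ≤ i ≤ length - 2`) is an ascent if `w_i < w_{i+1}`. -/
def ascentSet (w : List ℕ) : Finset ℕ :=
  (Finset.range (w.length - 1)).filter fun i => w.getD i 0 < w.getD (i + 1) 0

/-- The set of (0-indexed) descent positions of a word. Position `i` (for
`0 ≤ i ≤ length - 2`) is a descent if `w_i > w_{i+1}`. -/
def descentSet (w : List ℕ) : Finset ℕ :=
  (Finset.range (w.length - 1)).filter fun i => w.getD (i + 1) 0 < w.getD i 0

/-- The number of descents of a permutation. -/
def descentCount {n : ℕ} (π : Equiv.Perm (Fin n)) : ℕ :=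
  (descentSet (permWord π)).card

/-- A permutation is ballot if every prefix of its one-line notation has at least
as many ascents as descents. -/
def IsBallot {n : ℕ} (π : Equiv.Perm (Fin n)) : Prop :=
  ∀ k, k ≤ n →
    (descentSet ((permWord π).take k)).card ≤ (ascentSet ((permWord π).take k)).card

/-- The Eulerian number `E(n,d)`: the number of permutations of `{1,…,n}` with
exactly `d` descents.  (`E(0,0) = 1` and `E(0,d) = 0` for `d ≥ 1`.) -/
noncomputable def eulerianNum (n d : ℕ) : ℕ :=
  (Finset.univ.filter fun π : Equiv.Perm (Fin n) => descentCount π = d).card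

/-- `M(c)` for a cycle `c`: the minimum of the number of cyclic ascents and the
number of cyclic descents of `c`. -/
noncomputable def cycleM {n : ℕ} (c : Equiv.Perm (Fin n)) : ℕ :=
  min ((c.support.filter fun x => x < c x).card) ((c.support.filter fun x => c x < x).card)

/-- `M(π)`: the sum of `M(c)` over the cycles `c` of the cycle decomposition of `π`
(fixed points contribute `0`). -/
noncomputable def permM {n : ℕ} (π : Equiv.Perm (Fin n)) : ℕ :=
  ∑ c ∈ π.cycleFactorsFinset, cycleM c

/-- The number of ballot permutations of `{1,…,n}`. -/
noncomputable def ballotTotal (n : ℕ) : ℕ :=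
  (Finset.univ.filter fun π : Equiv.Perm (Fin n) => IsBallot π).card

/-- The number of permutations of `{1,…,n}` of odd order. -/
noncomputable def oddOrderTotal (n : ℕ) : ℕ :=
  (Finset.univ.filter fun π : Equiv.Perm (Fin n) => Odd (orderOf π)).card

/-- `b(n,d)`: the number of ballot permutations of `{1,…,n}` with exactly `d` descents. -/
noncomputable def bCount (n d : ℕ) : ℕ :=
  (Finset.univ.filter fun π : Equiv.Perm (Fin n) => IsBallot π ∧ descentCount π = d).card

/-- `p(n,d)`: the number of odd order permutations `π` of `{1,…,n}` with `M(π) = d`. -/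
noncomputable def pCount (n d : ℕ) : ℕ :=
  (Finset.univ.filter fun π : Equiv.Perm (Fin n) => Odd (orderOf π) ∧ permM π = d).card

/-- The Eulerian–Catalan numbers: `EC(n) = 2·E(2n, n-1)`, with `EC(0) = 1`. -/
noncomputable def eulerianCatalan (n : ℕ) : ℕ :=
  if n = 0 then 1 else 2 * eulerianNum (2 * n) (n - 1)

section OddCycles

open Function Equiv Equiv.Perm

/-- Every cycle of `σ` has odd length. -/
def AllCyclesOdd {α : Type*} (σ : Perm α) : Prop :=
  ∀ x, Odd (minimalPeriod σ x)

/-- The cycle of `σ` through `a` has even length, and every other cycle has odd length. -/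
def OnlyEvenCycleAt {α : Type*} (σ : Perm α) (a : α) : Prop :=
  Even (minimalPeriod σ a) ∧ ∀ x, ¬ σ.SameCycle a x → Odd (minimalPeriod σ x)

theorem minimalPeriod_permCongr {α β : Type*} (e : α ≃ β) (σ : Perm α) (x : α) :
    minimalPeriod (e.permCongr σ) (e x) = minimalPeriod σ x := by
  rw [minimalPeriod_eq_minimalPeriod_iff]
  intro n
  have h : ∀ n, (e.permCongr σ)^[n] (e x) = e (σ^[n] x) := by
    intro n
    induction n with
    | zero => rfl
    | succ k ih => rw [iterate_succ_apply', iterate_succ_apply', ih]; simp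
  simp [IsPeriodicPt, IsFixedPt, h]

theorem sameCycle_permCongr {α β : Type*} (e : α ≃ β) (σ : Perm α) (x y : α) :
    (e.permCongr σ).SameCycle (e x) (e y) ↔ σ.SameCycle x y := by
  have h : ∀ k : ℤ, (e.permCongr σ ^ k) (e x) = e ((σ ^ k) x) := by
    intro k
    have : e.permCongr σ ^ k = e.permCongr (σ ^ k) := (map_zpow e.permCongrHom σ k).symm
    rw [this]; simp
  simp [SameCycle, h]

theorem allCyclesOdd_permCongr {α β : Type*} (e : α ≃ β) (σ : Perm α) :
    AllCyclesOdd (e.permCongr σ) ↔ AllCyclesOdd σ := by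
  simp only [AllCyclesOdd]
  rw [← e.forall_congr_right]
  simp only [minimalPeriod_permCongr]

theorem onlyEvenCycleAt_permCongr {α β : Type*} (e : α ≃ β) (σ : Perm α) (a : α) :
    OnlyEvenCycleAt (e.permCongr σ) (e a) ↔ OnlyEvenCycleAt σ a := by
  simp only [OnlyEvenCycleAt]
  rw [← e.forall_congr_right]
  simp only [minimalPeriod_permCongr, sameCycle_permCongr]

theorem minimalPeriod_sameCycle {α : Type*} [Finite α] {σ : Perm α} {x y : α}
    (h : σ.SameCycle x y) : minimalPeriod σ x = minimalPeriod σ y := by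
  obtain ⟨k, -, rfl⟩ := h.exists_pow_eq'
  rw [← iterate_eq_pow,
    minimalPeriod_apply_iterate (σ.injective.mem_periodicPts x)]

section Insert

variable {α : Type*} [DecidableEq α] (σ : Perm α) (a : α)

/-- The permutation of `Option α` inserting `none` right before `a` in its cycle in `σ`. -/
def insertBefore : Perm (Option α) :=
  swap none (some a) * optionCongr σ

theorem insertBefore_none : insertBefore σ a none = some a := by
  simp [insertBefore]

theorem insertBefore_some (x : α) :
    insertBefore σ a (some x) = if σ x = a then none else some (σ x) := by
  split_ifs with h <;> simp [insertBefore, h, swap_apply_def]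

theorem insertBefore_iterate_none (j : ℕ) (hj : j < minimalPeriod σ a) :
    (insertBefore σ a)^[j + 1] none = some (σ^[j] a) := by
  induction j with
  | zero => simp [insertBefore_none]
  | succ k ih =>
    rw [iterate_succ_apply', ih (by omega), insertBefore_some, if_neg, iterate_succ_apply']
    rw [← iterate_succ_apply' (⇑σ)]
    exact not_isPeriodicPt_of_pos_of_lt_minimalPeriod (by omega) hj

theorem minimalPeriod_insertBefore_none [Finite α] :
    minimalPeriod (insertBefore σ a) none = minimalPeriod σ a + 1 := by
  have hpos : 0 < minimalPeriod σ a :=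
    minimalPeriod_pos_of_mem_periodicPts (σ.injective.mem_periodicPts a)
  obtain ⟨p, hp⟩ : ∃ p, minimalPeriod σ a = p + 1 := ⟨_, (Nat.succ_pred_eq_of_pos hpos).symm⟩
  have hper : IsPeriodicPt (insertBefore σ a) (minimalPeriod σ a + 1) none := by
    rw [IsPeriodicPt, IsFixedPt, iterate_succ_apply', hp,
      insertBefore_iterate_none σ a p (by omega), insertBefore_some, if_pos]
    rw [← iterate_succ_apply' (⇑σ), Nat.succ_eq_add_one, ← hp]
    exact isPeriodicPt_minimalPeriod σ a
  refine le_antisymm (hper.minimalPeriod_le (by omega)) ?_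
  by_contra! hlt
  have hq := minimalPeriod_pos_of_mem_periodicPts
    ((insertBefore σ a).injective.mem_periodicPts none)
  obtain ⟨q, hq⟩ : ∃ q, minimalPeriod (insertBefore σ a) none = q + 1 :=
    ⟨_, (Nat.succ_pred_eq_of_pos hq).symm⟩
  have h := isPeriodicPt_minimalPeriod (insertBefore σ a) none
  rw [hq, IsPeriodicPt, IsFixedPt, insertBefore_iterate_none σ a q (by omega)] at h
  cases h

theorem insertBefore_iterate_some {x : α} (hx : ¬ σ.SameCycle a x) (j : ℕ) :
    (insertBefore σ a)^[j] (some x) = some (σ^[j] x) := by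
  induction j with
  | zero => rfl
  | succ k ih =>
    rw [iterate_succ_apply', ih, insertBefore_some, if_neg, iterate_succ_apply']
    rw [← iterate_succ_apply' (⇑σ), iterate_eq_pow]
    exact fun h => hx (SameCycle.symm ⟨(k.succ : ℤ), by rw [zpow_natCast]; exact h⟩)

theorem minimalPeriod_insertBefore_some {x : α} (hx : ¬ σ.SameCycle a x) :
    minimalPeriod (insertBefore σ a) (some x) = minimalPeriod σ x := by
  rw [minimalPeriod_eq_minimalPeriod_iff]
  intro n
  simp [IsPeriodicPt, IsFixedPt, insertBefore_iterate_some σ a hx]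

theorem sameCycle_insertBefore [Finite α] (x : α) :
    (insertBefore σ a).SameCycle none (some x) ↔ σ.SameCycle a x := by
  constructor
  · intro h
    by_contra hx
    obtain ⟨k, -, hk⟩ := h.symm.exists_pow_eq'
    rw [← iterate_eq_pow, insertBefore_iterate_some σ a hx] at hk
    exact Option.some_ne_none _ hk
  · intro h
    obtain ⟨k, -, rfl⟩ := h.exists_pow_eq'
    rw [← iterate_eq_pow, ← iterate_mod_minimalPeriod_eq,
      ← insertBefore_iterate_none σ a (k % minimalPeriod σ a) (Nat.mod_lt _
        (minimalPeriod_pos_of_mem_periodicPts (σ.injective.mem_periodicPts a)))]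
    exact ⟨((k % minimalPeriod σ a + 1 : ℕ) : ℤ), by rw [zpow_natCast, iterate_eq_pow]⟩

theorem allCyclesOdd_insertBefore [Finite α] :
    AllCyclesOdd (insertBefore σ a) ↔ OnlyEvenCycleAt σ a := by
  constructor
  · intro h
    refine ⟨?_, fun x hx => ?_⟩
    · have := h none
      rw [minimalPeriod_insertBefore_none] at this
      simpa [Nat.odd_add_one] using this
    · rw [← minimalPeriod_insertBefore_some σ a hx]
      exact h _
  · rintro ⟨h1, h2⟩
    have h0 : Odd (minimalPeriod (insertBefore σ a) none) := by
      rw [minimalPeriod_insertBefore_none]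
      exact h1.add_one
    rintro (_ | x)
    · exact h0
    · by_cases hx : σ.SameCycle a x
      · rwa [← minimalPeriod_sameCycle ((sameCycle_insertBefore σ a x).2 hx)]
      · rw [minimalPeriod_insertBefore_some σ a hx]
        exact h2 x hx

theorem onlyEvenCycleAt_insertBefore [Finite α] :
    OnlyEvenCycleAt (insertBefore σ a) none ↔ AllCyclesOdd σ := by
  have h0 : Even (minimalPeriod (insertBefore σ a) none) ↔ Odd (minimalPeriod σ a) := by
    rw [minimalPeriod_insertBefore_none, Nat.even_add_one, Nat.not_even_iff_odd]
  constructor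
  · rintro ⟨h1, h2⟩ x
    by_cases hx : σ.SameCycle a x
    · rw [← minimalPeriod_sameCycle hx]
      exact h0.1 h1
    · rw [← minimalPeriod_insertBefore_some σ a hx]
      exact h2 _ (by rwa [sameCycle_insertBefore])
  · refine fun h => ⟨h0.2 (h a), ?_⟩
    rintro (_ | x) hx
    · exact absurd (SameCycle.refl _ _) hx
    · rw [sameCycle_insertBefore] at hx
      rw [minimalPeriod_insertBefore_some σ a hx]
      exact h x

end Insert

theorem optionCongr_iterate_some {α : Type*} (σ : Perm α) (x : α) (j : ℕ) :
    (optionCongr σ)^[j] (some x) = some (σ^[j] x) := by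
  induction j with
  | zero => rfl
  | succ k ih => rw [iterate_succ_apply', ih, iterate_succ_apply']; simp

theorem minimalPeriod_optionCongr_none {α : Type*} (σ : Perm α) :
    minimalPeriod (optionCongr σ) none = 1 :=
  minimalPeriod_eq_one_iff_isFixedPt.2 (by simp [IsFixedPt])

theorem allCyclesOdd_optionCongr {α : Type*} (σ : Perm α) :
    AllCyclesOdd (optionCongr σ) ↔ AllCyclesOdd σ := by
  have h : ∀ x, minimalPeriod (optionCongr σ) (some x) = minimalPeriod σ x := fun x => by
    rw [minimalPeriod_eq_minimalPeriod_iff]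
    intro n
    rw [IsPeriodicPt, IsFixedPt, optionCongr_iterate_some, Option.some_inj]
    rfl
  simp only [AllCyclesOdd, Option.forall, h, minimalPeriod_optionCongr_none, odd_one, true_and]

theorem not_onlyEvenCycleAt_optionCongr {α : Type*} (σ : Perm α) :
    ¬ OnlyEvenCycleAt (optionCongr σ) none := by
  rintro ⟨h, -⟩
  rw [minimalPeriod_optionCongr_none] at h
  exact absurd h (by decide)

theorem card_filter_perm_option {α : Type*} [Fintype α] [DecidableEq α]
    (P : Perm (Option α) → Prop) :
    #{τ : Perm (Option α) | P τ} =
      #{σ : Perm α | P (optionCongr σ)} + ∑ a : α, #{σ : Perm α | P (insertBefore σ a)} := by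
  simp only [card_filter]
  rw [← decomposeOption.symm.sum_comp, Fintype.sum_prod_type, Fintype.sum_option]
  congr 1
  refine sum_congr rfl fun σ _ => ?_
  rw [decomposeOption_symm_apply, swap_self]
  rfl

theorem card_allCyclesOdd_congr {α β : Type*} [Fintype α] [Fintype β]
    [DecidableEq α] [DecidableEq β] (e : α ≃ β) :
    #{σ : Perm α | AllCyclesOdd σ} = #{σ : Perm β | AllCyclesOdd σ} := by
  simp only [card_filter]
  rw [← e.permCongr.sum_comp]
  simp only [allCyclesOdd_permCongr]

theorem card_onlyEvenCycleAt_congr {α β : Type*} [Fintype α] [Fintype β]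
    [DecidableEq α] [DecidableEq β] (e : α ≃ β) (a : α) :
    #{σ : Perm α | OnlyEvenCycleAt σ a} = #{σ : Perm β | OnlyEvenCycleAt σ (e a)} := by
  simp only [card_filter]
  rw [← e.permCongr.sum_comp]
  simp only [onlyEvenCycleAt_permCongr]

theorem card_onlyEvenCycleAt (n : ℕ) (a : Fin (n + 1)) :
    #{σ : Perm (Fin (n + 1)) | OnlyEvenCycleAt σ a} =
      n * #{σ : Perm (Fin n) | AllCyclesOdd σ} := by
  rw [card_onlyEvenCycleAt_congr (finSuccEquiv' a), finSuccEquiv'_at, card_filter_perm_option]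
  simp [onlyEvenCycleAt_insertBefore, not_onlyEvenCycleAt_optionCongr]

theorem card_allCyclesOdd_add_two (n : ℕ) :
    #{σ : Perm (Fin (n + 2)) | AllCyclesOdd σ} =
      #{σ : Perm (Fin (n + 1)) | AllCyclesOdd σ} +
        (n + 1) * n * #{σ : Perm (Fin n) | AllCyclesOdd σ} := by
  rw [card_allCyclesOdd_congr (finSuccEquiv' 0), card_filter_perm_option]
  simp [allCyclesOdd_insertBefore, allCyclesOdd_optionCongr, card_onlyEvenCycleAt, mul_assoc]

theorem odd_orderOf_iff_allCyclesOdd {α : Type*} [Fintype α] (σ : Perm α) :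
    Odd (orderOf σ) ↔ AllCyclesOdd σ := by
  constructor
  · intro h x
    refine h.of_dvd_nat (IsPeriodicPt.minimalPeriod_dvd ?_)
    rw [IsPeriodicPt, IsFixedPt, iterate_eq_pow, pow_orderOf_eq_one, one_apply]
  · intro h
    have hodd : Odd (∏ x : α, minimalPeriod σ x) := by
      refine prod_induction _ (fun m : ℕ => Odd m) (fun _ _ => Odd.mul) odd_one fun x _ => h x
    refine hodd.of_dvd_nat (orderOf_dvd_of_pow_eq_one (Equiv.ext fun x => ?_))
    rw [← iterate_eq_pow, one_apply]
    exact (isPeriodicPt_minimalPeriod σ x).trans_dvd (dvd_prod_of_mem _ (mem_univ x))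

end OddCycles

/-- The exponential generating function of a sequence of natural numbers. -/
noncomputable def expGenFun (p : ℕ → ℕ) : PowerSeries ℚ :=
  PowerSeries.mk fun n => (p n : ℚ) / n.factorial

open PowerSeries in
theorem coeff_expGenFun_sq (p : ℕ → ℕ) (n : ℕ) :
    coeff n (expGenFun p ^ 2) =
      ((∑ k ∈ range (n + 1), n.choose k * (p k * p (n - k)) : ℕ) : ℚ) / n.factorial := by
  rw [pow_two, coeff_mul, Finset.Nat.sum_antidiagonal_eq_sum_range_succ_mk]
  push_cast
  rw [Finset.sum_div]
  refine sum_congr rfl fun k hk => ?_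
  have hk : k ≤ n := by simpa [Nat.lt_succ_iff] using hk
  rw [Nat.cast_choose ℚ hk]
  simp only [expGenFun, coeff_mk]
  have := Nat.cast_ne_zero (R := ℚ).2 (Nat.factorial_ne_zero n)
  field_simp

open PowerSeries in
theorem expGenFun_injective : Function.Injective expGenFun := by
  intro p q h
  funext n
  have := congrArg (coeff n) h
  have hn := Nat.cast_ne_zero (R := ℚ).2 (Nat.factorial_ne_zero n)
  simpa [expGenFun, div_left_inj' hn] using this

open PowerSeries in
/-- A sequence with positive initial value is determined by its binomial self-convolution. -/
theorem eq_of_sum_choose_mul_eq {p q : ℕ → ℕ} (hp : p 0 ≠ 0)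
    (h : ∀ n, ∑ k ∈ range (n + 1), n.choose k * (p k * p (n - k)) =
      ∑ k ∈ range (n + 1), n.choose k * (q k * q (n - k))) : p = q := by
  have hsq : expGenFun p ^ 2 = expGenFun q ^ 2 := by
    ext n
    rw [coeff_expGenFun_sq, coeff_expGenFun_sq, h]
  rcases sq_eq_sq_iff_eq_or_eq_neg.1 hsq with h | h
  · exact expGenFun_injective h
  · have := congrArg (coeff 0) h
    simp only [expGenFun, map_neg, coeff_mk, Nat.factorial_zero, Nat.cast_one, div_one] at this
    have hp : (0 : ℚ) < p 0 := by exact_mod_cast Nat.pos_of_ne_zero hp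
    have hq : (0 : ℚ) ≤ q 0 := by positivity
    linarith

open PowerSeries in
theorem one_sub_X_sq_mul_derivative_expGenFun {p : ℕ → ℕ} (h1 : p 1 = p 0)
    (hrec : ∀ n, p (n + 2) = p (n + 1) + (n + 1) * n * p n) :
    (1 - X ^ 2) * derivative ℚ (expGenFun p) = expGenFun p := by
  ext n
  rw [sub_mul, one_mul, map_sub, coeff_X_pow_mul', coeff_derivative]
  rcases n with _ | _ | n
  · simp [expGenFun, h1]
  · simp [expGenFun, hrec 0, h1]
    ring
  · rw [if_pos (by omega), show n + 1 + 1 - 2 = n by omega, coeff_derivative]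
    simp only [expGenFun, coeff_mk, hrec (n + 1), Nat.factorial_succ]
    push_cast
    have := Nat.cast_ne_zero (R := ℚ).2 (Nat.factorial_ne_zero n)
    field_simp
    ring

open PowerSeries in
theorem coeff_eq_two_of_derivative {F : PowerSeries ℚ} (h0 : coeff 0 F = 1)
    (hF : (1 - X ^ 2) * derivative ℚ F = 2 * F) (n : ℕ) : coeff (n + 1) F = 2 := by
  have hc : ∀ n, coeff (n + 1) F * (n + 1) - (if 2 ≤ n then coeff (n - 2 + 1) F * ((n - 2 : ℕ) + 1)
      else 0) = 2 * coeff n F := by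
    intro n
    have := congrArg (coeff n) hF
    rw [sub_mul, one_mul, map_sub, coeff_X_pow_mul', coeff_derivative, coeff_derivative,
      two_mul, map_add, ← two_mul] at this
    exact this
  induction n using Nat.strong_induction_on with
  | _ n ih =>
    have := hc n
    rcases n with _ | _ | n
    · simpa [h0] using this
    · simp only [ih 0 (by omega)] at this
      norm_num at this ⊢
      linarith
    · rw [if_pos (by omega), show n + 1 + 1 - 2 = n by omega, ih n (by omega), ih (n + 1) (by omega)] at this
      push_cast at this
      have hn : (n : ℚ) + 3 ≠ 0 := by positivity
      apply mul_right_cancel₀ hn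
      linarith

open PowerSeries in
theorem sum_choose_mul_eq_two_mul_factorial {p : ℕ → ℕ} (h0 : p 0 = 1) (h1 : p 1 = 1)
    (hrec : ∀ n, p (n + 2) = p (n + 1) + (n + 1) * n * p n) {n : ℕ} (hn : n ≠ 0) :
    ∑ k ∈ range (n + 1), n.choose k * (p k * p (n - k)) = 2 * n.factorial := by
  obtain ⟨n, rfl⟩ := Nat.exists_eq_succ_of_ne_zero hn
  have hA := one_sub_X_sq_mul_derivative_expGenFun (h1.trans h0.symm) hrec
  have h : coeff (n + 1) (expGenFun p ^ 2) = 2 := by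
    apply coeff_eq_two_of_derivative
    · rw [coeff_expGenFun_sq]
      simp [h0]
    · rw [pow_two (expGenFun p), Derivation.leibniz, smul_eq_mul]
      linear_combination 2 * expGenFun p * hA
  rw [coeff_expGenFun_sq, div_eq_iff (Nat.cast_ne_zero.2 (Nat.factorial_ne_zero _))] at h
  exact_mod_cast h

theorem doubleFactorial_closed_form {p : ℕ → ℕ} (h0 : p 0 = 1) (h1 : p 1 = 1)
    (hrec : ∀ n, p (n + 2) = p (n + 1) + (n + 1) * n * p n) (n : ℕ) :
    p n = if Even n then (Nat.doubleFactorial (n - 1)) ^ 2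
      else Nat.doubleFactorial n * Nat.doubleFactorial (n - 2) := by
  have key : ∀ m, p (2 * m) = (Nat.doubleFactorial (2 * m - 1)) ^ 2 ∧
      p (2 * m + 1) = Nat.doubleFactorial (2 * m + 1) * Nat.doubleFactorial (2 * m - 1) := by
    intro m
    induction m with
    | zero => simp [h0, h1]
    | succ m ih =>
      have hd : Nat.doubleFactorial (2 * m + 1) = (2 * m + 1) * Nat.doubleFactorial (2 * m - 1) := by
        rcases m with _ | m
        · simp
        · exact Nat.doubleFactorial_add_two (2 * m + 1)
      have heven : p (2 * (m + 1)) = (Nat.doubleFactorial (2 * (m + 1) - 1)) ^ 2 := by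
        rw [show 2 * (m + 1) = 2 * m + 2 by ring, hrec, ih.1, ih.2,
          show 2 * m + 2 - 1 = 2 * m + 1 by omega, hd]
        ring
      refine ⟨heven, ?_⟩
      rw [show 2 * (m + 1) + 1 = 2 * m + 1 + 2 by ring, hrec,
        show 2 * m + 1 + 1 = 2 * (m + 1) by ring, heven, ih.2, Nat.doubleFactorial_add_two,
        show 2 * (m + 1) - 1 = 2 * m + 1 by omega, hd]
      ring
  split_ifs with h
  · obtain ⟨m, rfl⟩ := h.exists_two_nsmul
    exact (key m).1
  · obtain ⟨m, rfl⟩ := Nat.not_even_iff_odd.1 h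
    rw [(key m).2, show 2 * m + 1 - 2 = 2 * m - 1 by omega]

/-- The height after `m` steps of the lattice path rising at each ascent of `w` and falling
elsewhere. -/
def height (w : ℕ → ℕ) (m : ℕ) : ℤ :=
  ∑ j ∈ range m, if w j < w (j + 1) then 1 else -1

theorem height_succ (w : ℕ → ℕ) (m : ℕ) :
    height w (m + 1) = height w m + if w m < w (m + 1) then 1 else -1 :=
  sum_range_succ _ _

/-- The lattice path of the word `l` never goes below its starting point. -/
def BallotWord (l : List ℕ) : Prop :=
  ∀ m < l.length, 0 ≤ height (fun i => l.getD i 0) m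

theorem height_congr {v w : ℕ → ℕ} {m : ℕ}
    (h : ∀ j < m, (v j < v (j + 1) ↔ w j < w (j + 1))) : height v m = height w m :=
  sum_congr rfl fun j hj => by simp only [h j (mem_range.1 hj)]

theorem height_shift (w : ℕ → ℕ) (k m : ℕ) :
    height (fun i => w (k + i)) m = height w (k + m) - height w k := by
  simp only [height, sum_range_add, ← add_assoc, add_sub_cancel_left]

theorem height_reflect {v w : ℕ → ℕ} {k m : ℕ} (hm : m ≤ k)
    (hw : ∀ i < k, w i ≠ w (i + 1)) (h : ∀ i ≤ k, v i = w (k - i)) :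
    height v m = height w (k - m) - height w k := by
  induction m with
  | zero => simp [height]
  | succ m ih =>
    have hk : k - m = (k - (m + 1)) + 1 := by omega
    have hne := hw (k - (m + 1)) (by omega)
    rw [height_succ, ih (by omega), h m (by omega), h (m + 1) hm, hk, height_succ]
    split_ifs <;> omega

theorem getD_ne_getD_succ {l : List ℕ} (hl : l.Nodup) {i : ℕ} (hi : i + 1 < l.length) :
    l.getD i 0 ≠ l.getD (i + 1) 0 := by
  rw [List.getD_eq_getElem _ _ (by omega), List.getD_eq_getElem _ _ hi, Ne, hl.getElem_inj_iff]
  omega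

theorem ballotWord_drop {l : List ℕ} {k : ℕ} :
    BallotWord (l.drop k) ↔
      ∀ i, k ≤ i → i < l.length →
        height (fun i => l.getD i 0) k ≤ height (fun i => l.getD i 0) i := by
  have h : ∀ m, height (fun i => (l.drop k).getD i 0) m =
      height (fun i => l.getD i 0) (k + m) - height (fun i => l.getD i 0) k := by
    intro m
    rw [← height_shift]
    simp [List.getD_eq_getElem?_getD]
  simp only [BallotWord, h, sub_nonneg, List.length_drop]
  constructor
  · intro H i hki hi
    simpa [Nat.add_sub_cancel' hki] using H (i - k) (by omega)
  · exact fun H m hm => H _ (by omega) (by omega)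

theorem ballotWord_reverse_take {l : List ℕ} (hl : l.Nodup) {k : ℕ} (hk : k ≤ l.length) :
    BallotWord (l.take k).reverse ↔
      ∀ i < k, height (fun i => l.getD i 0) (k - 1) ≤ height (fun i => l.getD i 0) i := by
  have h : ∀ m < k, height (fun i => (l.take k).reverse.getD i 0) m =
      height (fun i => l.getD i 0) (k - 1 - m) - height (fun i => l.getD i 0) (k - 1) := by
    intro m hm
    refine height_reflect (by omega) (fun i hi => getD_ne_getD_succ hl (by omega)) fun i hi => ?_
    rw [List.getD_eq_getElem _ _ (by simp; omega), List.getD_eq_getElem _ _ (by omega)]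
    simp [Nat.min_eq_left hk]
  simp only [BallotWord, List.length_reverse, List.length_take, Nat.min_eq_left hk]
  constructor
  · intro H i hi
    have := H (k - 1 - i) (by omega)
    rw [h _ (by omega), show k - 1 - (k - 1 - i) = i by omega] at this
    linarith
  · intro H m hm
    rw [h m hm, sub_nonneg]
    exact H _ (by omega)

/-- A path with `±1` steps has exactly two cuts for which the left part ends at its minimum and
the right part starts at its minimum: before its first minimum and after its last minimum. -/
theorem card_minimal_cuts {h : ℕ → ℤ} {n : ℕ} (hn : n ≠ 0)
    (hstep : ∀ i, h (i + 1) = h i + 1 ∨ h (i + 1) = h i - 1) :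
    #{k ∈ range (n + 1) | (∀ i < k, h (k - 1) ≤ h i) ∧ ∀ i, k ≤ i → i < n → h k ≤ h i} = 2 := by
  have hne : ((range n).filter fun i => ∀ j < n, h i ≤ h j).Nonempty := by
    obtain ⟨i, hi, hmin⟩ := exists_min_image (range n) h ⟨0, by simp; omega⟩
    exact ⟨i, mem_filter.2 ⟨hi, fun j hj => hmin j (mem_range.2 hj)⟩⟩
  obtain ⟨a, ha, hamin⟩ := exists_min_image _ id hne
  obtain ⟨b, hb, hbmax⟩ := exists_max_image _ id hne
  simp only [mem_filter, mem_range, id] at ha hb hamin hbmax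
  have hab : a ≤ b := hamin b hb
  have hlt_a : ∀ i < a, h a + 1 ≤ h i := by
    intro i hi
    by_contra! hlt
    have := hamin i ⟨by omega, fun j hj => by have := ha.2 j hj; omega⟩
    omega
  have hlt_b : ∀ i, b < i → i < n → h b + 1 ≤ h i := by
    intro i hi hin
    by_contra! hlt
    have := hbmax i ⟨hin, fun j hj => by have := hb.2 j hj; omega⟩
    omega
  rw [show {k ∈ range (n + 1) | (∀ i < k, h (k - 1) ≤ h i) ∧ ∀ i, k ≤ i → i < n → h k ≤ h i} =
    {a, b + 1} from ?_, card_pair (by omega)]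
  ext k
  simp only [mem_filter, mem_range, mem_insert, mem_singleton]
  constructor
  · rintro ⟨hk, hl, hr⟩
    rcases k with _ | k
    · have := hr a (by omega) ha.1
      by_contra! hc
      have := hlt_a 0 (by omega)
      omega
    · rw [Nat.add_sub_cancel] at hl
      by_cases hkn : k + 1 < n
      · rcases hstep k with hs | hs
        · right
          have hmin : ∀ j < n, h k ≤ h j := by
            intro j hj
            rcases Nat.lt_or_ge j (k + 1) with hjk | hjk
            · exact hl j hjk
            · have := hr j hjk hj
              omega
          have h1 := hbmax k ⟨by omega, hmin⟩
          by_contra! hc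
          have h2 := hr b (by omega) hb.1
          have h3 := hb.2 k (by omega)
          omega
        · left
          have hmin : ∀ j < n, h (k + 1) ≤ h j := by
            intro j hj
            rcases Nat.lt_or_ge j (k + 1) with hjk | hjk
            · have := hl j hjk
              omega
            · exact hr j hjk hj
          have h1 := hamin (k + 1) ⟨by omega, hmin⟩
          by_contra! hc
          have h2 := hl a (by omega)
          have h3 := ha.2 (k + 1) (by omega)
          omega
      · right
        obtain rfl : n = k + 1 := by omega
        have h1 := hbmax k ⟨by omega, hl⟩
        omega
  · rintro (rfl | rfl)
    · refine ⟨by omega, fun i hi => ?_, fun i _ hi => ha.2 i hi⟩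
      have h1 := hlt_a i hi
      have h2 := hlt_a (k - 1) (by omega)
      have h3 := hstep (k - 1)
      rw [Nat.sub_add_cancel (by omega)] at h3
      omega
    · refine ⟨by omega, fun i hi => hb.2 i (by omega), fun i hi hin => ?_⟩
      have h1 := hlt_b i hi hin
      have h2 := hstep b
      omega

theorem card_ballot_cuts {l : List ℕ} (hl : l.Nodup) (h0 : l ≠ []) :
    #{k ∈ range (l.length + 1) | BallotWord (l.take k).reverse ∧ BallotWord (l.drop k)} = 2 := by
  rw [← card_minimal_cuts (h := height fun i => l.getD i 0) (List.length_pos_iff.2 h0).ne']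
  · refine congrArg card (filter_congr fun k hk => ?_)
    rw [ballotWord_reverse_take hl (by simpa [Nat.lt_succ_iff] using hk), ballotWord_drop]
  · intro i
    rw [height_succ]
    split_ifs
    · exact Or.inl rfl
    · exact Or.inr rfl

/-- The arrangements of the elements of `S` into a word without repetition. -/
noncomputable def arrangements (S : Finset ℕ) : Finset (List ℕ) :=
  S.toList.permutations.toFinset

theorem mem_arrangements {S : Finset ℕ} {l : List ℕ} :
    l ∈ arrangements S ↔ l.Nodup ∧ l.toFinset = S := by
  rw [arrangements, List.mem_toFinset, List.mem_permutations]
  constructor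
  · intro h
    exact ⟨h.nodup_iff.2 S.nodup_toList, by rw [List.toFinset_eq_of_perm _ _ h, toList_toFinset]⟩
  · rintro ⟨h, rfl⟩
    exact (List.toFinset_toList h).symm

theorem card_arrangements (S : Finset ℕ) : #(arrangements S) = (#S).factorial := by
  rw [arrangements, List.toFinset_card_of_nodup (List.nodup_permutations _ S.nodup_toList),
    List.length_permutations, length_toList]

theorem card_reverse_ballot (S : Finset ℕ) :
    #{l ∈ arrangements S | BallotWord l.reverse} = #{l ∈ arrangements S | BallotWord l} := by
  refine card_nbij' List.reverse List.reverse ?_ ?_ ?_ ?_ <;>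
    intro l <;> simp +contextual [mem_arrangements]

theorem sum_card_ballot_mul_card_ballot (S : Finset ℕ) (hS : S.Nonempty) :
    ∑ T ∈ S.powerset, #{l ∈ arrangements T | BallotWord l} *
      #{l ∈ arrangements (S \ T) | BallotWord l} = 2 * (#S).factorial := by
  calc
    _ = ∑ T ∈ S.powerset, #({l ∈ arrangements T | BallotWord l.reverse} ×ˢ
          {l ∈ arrangements (S \ T) | BallotWord l}) := by
      simp only [card_product, card_reverse_ballot]
    _ = #(S.powerset.sigma fun T => {l ∈ arrangements T | BallotWord l.reverse} ×ˢ
          {l ∈ arrangements (S \ T) | BallotWord l}) := (card_sigma _ _).symm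
    _ = #((arrangements S).sigma fun l =>
          {k ∈ range (l.length + 1) | BallotWord (l.take k).reverse ∧ BallotWord (l.drop k)}) := by
      refine card_nbij' (fun x => ⟨x.2.1 ++ x.2.2, x.2.1.length⟩)
        (fun y => ⟨(y.1.take y.2).toFinset, (y.1.take y.2, y.1.drop y.2)⟩) ?_ ?_ ?_ ?_
      · rintro ⟨T, u, v⟩ h
        simp only [coe_sigma, Set.mem_sigma_iff, mem_coe, mem_powerset, mem_product, mem_filter,
          mem_arrangements, mem_range] at h ⊢
        obtain ⟨hT, ⟨⟨hu, rfl⟩, hub⟩, ⟨hv, hvS⟩, hvb⟩ := h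
        refine ⟨⟨List.nodup_append'.2 ⟨hu, hv, ?_⟩, ?_⟩, by simp, by simpa using hub,
          by simpa using hvb⟩
        · intro a ha hb
          have : a ∈ S \ u.toFinset := hvS ▸ List.mem_toFinset.2 hb
          simp_all
        · rw [List.toFinset_append, hvS, union_sdiff_of_subset hT]
      · rintro ⟨l, k⟩ h
        simp only [coe_sigma, Set.mem_sigma_iff, mem_coe, mem_powerset, mem_product, mem_filter,
          mem_arrangements, mem_range] at h ⊢
        obtain ⟨⟨hl, rfl⟩, hk, hu, hv⟩ := h
        refine ⟨?_, ⟨⟨hl.sublist (List.take_sublist k l), trivial⟩, hu⟩,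
          ⟨hl.sublist (List.drop_sublist k l), ?_⟩, hv⟩
        · intro a ha
          exact List.mem_toFinset.2 (List.mem_of_mem_take (List.mem_toFinset.1 ha))
        · have hl' : (l.take k ++ l.drop k).Nodup := by rwa [List.take_append_drop]
          have hd := (List.nodup_append'.1 hl').2.2
          ext a
          have h1 := @hd a
          have h2 : a ∈ l ↔ a ∈ l.take k ∨ a ∈ l.drop k := by
            rw [← List.mem_append, List.take_append_drop]
          simp only [mem_sdiff, List.mem_toFinset, h2]
          tauto
      · rintro ⟨T, u, v⟩ h
        simp only [coe_sigma, Set.mem_sigma_iff, mem_coe, mem_powerset, mem_product, mem_filter,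
          mem_arrangements] at h
        simp [h.2.1.1.2]
      · rintro ⟨l, k⟩ h
        simp only [coe_sigma, Set.mem_sigma_iff, mem_coe, mem_filter, mem_range] at h
        simp
        omega
    _ = ∑ l ∈ arrangements S, 2 := by
      rw [card_sigma]
      refine sum_congr rfl fun l hl => card_ballot_cuts (mem_arrangements.1 hl).1 ?_
      rintro rfl
      simp [mem_arrangements] at hl
      exact hS.ne_empty hl.symm
    _ = _ := by rw [sum_const, card_arrangements, smul_eq_mul, mul_comm]

theorem card_descentSet_le_card_ascentSet_take {l : List ℕ} (hl : l.Nodup) {k : ℕ}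
    (hk : k ≤ l.length) :
    #(descentSet (l.take k)) ≤ #(ascentSet (l.take k)) ↔
      0 ≤ height (fun i => l.getD i 0) (k - 1) := by
  have hget : ∀ i < k, (l.take k).getD i 0 = l.getD i 0 := by
    intro i hi
    simp [List.getD_eq_getElem?_getD, hi]
  have hasc : ascentSet (l.take k) =
      {i ∈ range (k - 1) | l.getD i 0 < l.getD (i + 1) 0} := by
    rw [ascentSet, List.length_take, Nat.min_eq_left hk]
    refine filter_congr fun i hi => ?_
    rw [mem_range] at hi
    rw [hget i (by omega), hget (i + 1) (by omega)]
  have hdesc : descentSet (l.take k) =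
      {i ∈ range (k - 1) | ¬ l.getD i 0 < l.getD (i + 1) 0} := by
    rw [descentSet, List.length_take, Nat.min_eq_left hk]
    refine filter_congr fun i hi => ?_
    rw [mem_range] at hi
    have := getD_ne_getD_succ hl (i := i) (by omega)
    rw [hget i (by omega), hget (i + 1) (by omega)]
    omega
  rw [hasc, hdesc, height, sum_ite]
  simp only [sum_const, nsmul_eq_mul]
  omega

theorem nodup_permWord {n : ℕ} (π : Equiv.Perm (Fin n)) : (permWord π).Nodup :=
  (List.nodup_finRange n).map fun _ _ h => π.injective (Fin.ext (Nat.succ_injective h))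

theorem length_permWord {n : ℕ} (π : Equiv.Perm (Fin n)) : (permWord π).length = n := by
  simp [permWord]

theorem isBallot_iff_ballotWord {n : ℕ} (π : Equiv.Perm (Fin n)) :
    IsBallot π ↔ BallotWord (permWord π) := by
  have h : ∀ k ≤ n, _ := fun k hk =>
    card_descentSet_le_card_ascentSet_take (nodup_permWord π) (hk.trans_eq (length_permWord π).symm)
  rw [IsBallot, BallotWord, length_permWord]
  constructor
  · exact fun H m hm => (h (m + 1) hm).1 (H _ hm)
  · intro H k hk
    rw [h k hk]
    rcases k with _ | k
    · simp [height]
    · exact H _ (by omega)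

theorem ballotWord_map_finRange_congr {n : ℕ} {f g : Fin n → ℕ}
    (h : ∀ i j, f i < f j ↔ g i < g j) :
    BallotWord ((List.finRange n).map f) ↔ BallotWord ((List.finRange n).map g) := by
  simp only [BallotWord, List.length_map, List.length_finRange]
  refine forall₂_congr fun m hm => ?_
  rw [height_congr fun j hj => ?_]
  rw [List.getD_eq_getElem _ _ (by simp; omega), List.getD_eq_getElem _ _ (by simp; omega),
    List.getD_eq_getElem _ _ (by simp; omega), List.getD_eq_getElem _ _ (by simp; omega)]
  simp [h]

theorem card_ballot_arrangements (S : Finset ℕ) :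
    #{l ∈ arrangements S | BallotWord l} = ballotTotal (#S) := by
  let e := S.orderIsoOfFin rfl
  rw [ballotTotal]
  symm
  refine card_nbij (fun π => (List.finRange (#S)).map fun i => (e (π i) : ℕ)) ?_ ?_ ?_
  · intro π hπ
    simp only [mem_coe, mem_filter, mem_univ, true_and, mem_arrangements] at hπ ⊢
    refine ⟨⟨(List.nodup_finRange _).map fun i j h =>
      π.injective (e.injective (Subtype.ext h)), ?_⟩, ?_⟩
    · ext a
      simp only [List.mem_toFinset, List.mem_map, List.mem_finRange, true_and]
      constructor
      · rintro ⟨i, rfl⟩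
        exact (e (π i)).2
      · intro ha
        exact ⟨π.symm (e.symm ⟨a, ha⟩), by simp⟩
    · rw [isBallot_iff_ballotWord] at hπ
      refine (ballotWord_map_finRange_congr fun i j => ?_).1 hπ
      rw [Subtype.coe_lt_coe, e.lt_iff_lt]
      simp
  · intro π _ ρ _ h
    ext i
    have := List.map_inj_left.1 h i (List.mem_finRange i)
    rw [e.injective (Subtype.ext this)]
  · intro l hl
    simp only [mem_coe, mem_filter, mem_arrangements] at hl
    obtain ⟨⟨hl, hS⟩, hb⟩ := hl
    have hlen : l.length = #S := by rw [← hS, List.toFinset_card_of_nodup hl]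
    have hmem : ∀ i : Fin (#S), l.get (i.cast hlen.symm) ∈ S := fun i => by
      have h := List.mem_toFinset.2 (List.get_mem l (i.cast hlen.symm))
      rwa [hS] at h
    let f : Fin (#S) → Fin (#S) := fun i => e.symm ⟨_, hmem i⟩
    have hf : Function.Injective f := by
      intro i j hij
      have := congrArg Subtype.val (e.symm.injective hij)
      exact Fin.cast_injective _ (hl.injective_get this)
    let π : Equiv.Perm (Fin (#S)) := Equiv.ofBijective f (Finite.injective_iff_bijective.1 hf)
    have hπ : ((List.finRange (#S)).map fun i => (e (π i) : ℕ)) = l := by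
      refine List.ext_getElem (by simp [hlen]) fun i h1 h2 => ?_
      simp [π, f]
    refine ⟨π, ?_, hπ⟩
    simp only [mem_coe, mem_filter, mem_univ, true_and]
    rw [isBallot_iff_ballotWord]
    refine (ballotWord_map_finRange_congr fun i j => ?_).1 (hπ.symm ▸ hb)
    rw [Subtype.coe_lt_coe, e.lt_iff_lt]
    simp

theorem sum_choose_mul_ballotTotal {n : ℕ} (hn : n ≠ 0) :
    ∑ k ∈ range (n + 1), n.choose k * (ballotTotal k * ballotTotal (n - k)) =
      2 * n.factorial := by
  have h := sum_card_ballot_mul_card_ballot (range n) (nonempty_range_iff.2 hn)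
  rw [card_range] at h
  rw [← h]
  have hs := sum_powerset_apply_card (fun k => ballotTotal k * ballotTotal (n - k)) (x := range n)
  simp only [card_range, smul_eq_mul] at hs
  rw [← hs]
  refine sum_congr rfl fun T hT => ?_
  rw [card_ballot_arrangements, card_ballot_arrangements, card_sdiff_of_subset (mem_powerset.1 hT),
    card_range]

theorem ballotTotal_zero : ballotTotal 0 = 1 := by
  rw [ballotTotal, filter_true_of_mem]
  · simp
  · intro π _
    rw [isBallot_iff_ballotWord]
    exact fun m hm => absurd hm (by simp [permWord])

theorem oddOrderTotal_eq (n : ℕ) :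
    oddOrderTotal n = #{σ : Equiv.Perm (Fin n) | AllCyclesOdd σ} := by
  simp only [oddOrderTotal, odd_orderOf_iff_allCyclesOdd]

theorem oddOrderTotal_add_two (n : ℕ) :
    oddOrderTotal (n + 2) = oddOrderTotal (n + 1) + (n + 1) * n * oddOrderTotal n := by
  simp only [oddOrderTotal_eq, card_allCyclesOdd_add_two]

theorem oddOrderTotal_of_subsingleton (n : ℕ) [Subsingleton (Fin n)] : oddOrderTotal n = 1 := by
  have : Unique (Equiv.Perm (Fin n)) := Unique.mk' _
  rw [oddOrderTotal, filter_true_of_mem]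
  · rw [card_univ, Fintype.card_perm, Fintype.card_fin]
    exact Nat.factorial_eq_one.2 (Fin.subsingleton_iff_le_one.1 ‹_›)
  · intro σ _
    rw [Subsingleton.elim σ 1, orderOf_one]
    exact odd_one

theorem ballotTotal_eq_oddOrderTotal : ballotTotal = oddOrderTotal := by
  refine eq_of_sum_choose_mul_eq (by simp [ballotTotal_zero]) fun n => ?_
  rcases eq_or_ne n 0 with rfl | hn
  · simp [ballotTotal_zero, oddOrderTotal_of_subsingleton]
  · rw [sum_choose_mul_ballotTotal hn,
      sum_choose_mul_eq_two_mul_factorial (oddOrderTotal_of_subsingleton 0)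
        (oddOrderTotal_of_subsingleton 1) oddOrderTotal_add_two hn]

theorem ballot_eq_odd_order_count (n : ℕ) (hn : 1 ≤ n) :
    ballotTotal n = oddOrderTotal n ∧
      ballotTotal n =
        (if Even n then (Nat.doubleFactorial (n - 1)) ^ 2
         else Nat.doubleFactorial n * Nat.doubleFactorial (n - 2)) := by
  rw [ballotTotal_eq_oddOrderTotal]
  exact ⟨rfl, doubleFactorial_closed_form (oddOrderTotal_of_subsingleton 0)
    (oddOrderTotal_of_subsingleton 1) oddOrderTotal_add_two n⟩
end

section
/- For all n ≥ 1, b(n,1) = p(n,1) = 2·E(n−1,1), where E(n−1,1) = 2^{n−1} − (n−1) − 1. -/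
open Finset
open scoped Classical

/-- The descents of `π` are exactly the single position `d`. -/
def HasOnlyDescent {n : ℕ} (π : Equiv.Perm (Fin n)) (d : ℕ) : Prop :=
  d + 1 < n ∧ ∀ i (hi : i + 1 < n), π ⟨i + 1, hi⟩ < π ⟨i, by omega⟩ ↔ i = d

theorem permWord_getD {n : ℕ} (π : Equiv.Perm (Fin n)) {i : ℕ} (hi : i < n) :
    (permWord π).getD i 0 = π ⟨i, hi⟩ + 1 := by
  simp [permWord, List.getD_eq_getElem?_getD, hi]

theorem mem_descentSet_permWord {n : ℕ} (π : Equiv.Perm (Fin n)) {i : ℕ} :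
    i ∈ descentSet (permWord π) ↔ ∃ hi : i + 1 < n, π ⟨i + 1, hi⟩ < π ⟨i, by omega⟩ := by
  simp only [descentSet, length_permWord, mem_filter, mem_range]
  constructor
  · rintro ⟨h, h'⟩
    have hi : i + 1 < n := by omega
    rw [permWord_getD π hi, permWord_getD π (by omega : i < n)] at h'
    exact ⟨hi, by simpa using h'⟩
  · rintro ⟨hi, h'⟩
    rw [permWord_getD π hi, permWord_getD π (by omega : i < n)]
    exact ⟨by omega, by simpa using h'⟩

theorem descentSet_permWord_eq_singleton_iff {n : ℕ} (π : Equiv.Perm (Fin n)) (d : ℕ) :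
    descentSet (permWord π) = {d} ↔ HasOnlyDescent π d := by
  simp only [Finset.ext_iff, mem_descentSet_permWord, mem_singleton, HasOnlyDescent]
  constructor
  · intro h
    exact ⟨((h d).2 rfl).1, fun i hi => ⟨fun h' => (h i).1 ⟨hi, h'⟩, fun h' => ((h i).2 h').2⟩⟩
  · rintro ⟨hd, h⟩ i
    exact ⟨fun ⟨hi, h'⟩ => (h i hi).1 h', fun h' => ⟨by omega, (h i (by omega)).2 h'⟩⟩

theorem descentCount_eq_one_iff {n : ℕ} (π : Equiv.Perm (Fin n)) :
    descentCount π = 1 ↔ ∃ d, HasOnlyDescent π d := by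
  simp only [descentCount, card_eq_one, descentSet_permWord_eq_singleton_iff]

theorem perm_lt_of_forall_not_descent {n : ℕ} (π : Equiv.Perm (Fin n)) {i j : Fin n} (hij : i < j)
    (h : ∀ k (hk : k + 1 < n), (i : ℕ) ≤ k → k < j → ¬ π ⟨k + 1, hk⟩ < π ⟨k, by omega⟩) :
    π i < π j := by
  obtain ⟨i, hi⟩ := i
  obtain ⟨j, hj⟩ := j
  have step : ∀ k (hk : k + 1 < n), i ≤ k → k < j → π ⟨k, by omega⟩ < π ⟨k + 1, hk⟩ := by
    intro k hk h1 h2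
    refine lt_of_le_of_ne (not_lt.1 (h k hk h1 h2)) fun he => ?_
    simpa using π.injective he
  have key : ∀ m, i < m → ∀ hm : m < n, m ≤ j → π ⟨i, hi⟩ < π ⟨m, hm⟩ := by
    intro m him
    induction m, him using Nat.le_induction with
    | base => exact fun hm hmj => step i hm le_rfl hmj
    | succ m him ih =>
      intro hm hmj
      exact (ih (by omega) (by omega)).trans (step m hm (by omega) (by omega))
  exact key j hij hj le_rfl

theorem apply_sort_eq_of_descent {n : ℕ} (χ : Fin n → Bool) {i : ℕ} (hi : i + 1 < n)
    (h : Tuple.sort χ ⟨i + 1, hi⟩ < Tuple.sort χ ⟨i, by omega⟩) (j : Fin n) :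
    χ (Tuple.sort χ j) = decide (i < (j : ℕ)) := by
  obtain ⟨mono, hlt⟩ := Tuple.eq_sort_iff.1 (rfl : Tuple.sort χ = Tuple.sort χ)
  have hne : χ (Tuple.sort χ ⟨i, by omega⟩) ≠ χ (Tuple.sort χ ⟨i + 1, hi⟩) := fun he =>
    (hlt _ _ (by simp) he).not_gt h
  have hle : χ (Tuple.sort χ ⟨i, by omega⟩) ≤ χ (Tuple.sort χ ⟨i + 1, hi⟩) :=
    mono (by simp)
  obtain ⟨h0, h1⟩ := Bool.lt_iff.1 (lt_of_le_of_ne hle hne)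
  by_cases hj : i < (j : ℕ)
  · have : χ (Tuple.sort χ ⟨i + 1, hi⟩) ≤ χ (Tuple.sort χ j) := mono (Fin.le_def.2 hj)
    rw [h1] at this
    simpa only [hj, decide_true] using Bool.eq_true_of_true_le this
  · have : χ (Tuple.sort χ j) ≤ χ (Tuple.sort χ ⟨i, by omega⟩) :=
      mono (Fin.le_def.2 (by simpa using hj))
    rw [h0] at this
    simpa only [hj, decide_false] using Bool.eq_false_of_le_false this

theorem exists_hasOnlyDescent_sort {n : ℕ} {χ : Fin n → Bool} (hχ : ¬ Monotone χ) :
    ∃ d, HasOnlyDescent (Tuple.sort χ) d := by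
  have hex : ∃ d, ∃ hd : d + 1 < n, Tuple.sort χ ⟨d + 1, hd⟩ < Tuple.sort χ ⟨d, by omega⟩ := by
    by_contra! hcon
    apply hχ
    rw [← Tuple.sort_eq_refl_iff_monotone]
    refine (Equiv.Perm.monotone_iff _).1 (StrictMono.monotone fun i j hij => ?_)
    exact perm_lt_of_forall_not_descent _ hij fun k hk _ _ => not_lt.2 (hcon k hk)
  obtain ⟨d, hd, hdesc⟩ := hex
  refine ⟨d, hd, fun i hi => ⟨fun h => ?_, ?_⟩⟩
  · have hj := fun j => (apply_sort_eq_of_descent χ hi h j).symm.trans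
      (apply_sort_eq_of_descent χ hd hdesc j)
    have h1 := hj ⟨i, by omega⟩
    have h2 := hj ⟨d, by omega⟩
    simp at h1 h2
    omega
  · rintro rfl
    exact hdesc

theorem HasOnlyDescent.eq_sort {n : ℕ} {π : Equiv.Perm (Fin n)} {d : ℕ} (h : HasOnlyDescent π d) :
    π = Tuple.sort fun v => decide (d < (π.symm v : ℕ)) := by
  refine Tuple.eq_sort_iff.2 ⟨fun i j hij => ?_, fun i j hij he => ?_⟩
  · simp only [Function.comp, Equiv.symm_apply_apply]
    rw [Bool.le_iff_imp]
    simp only [decide_eq_true_eq]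
    exact fun hd => lt_of_lt_of_le hd hij
  · simp only [Equiv.symm_apply_apply, decide_eq_decide] at he
    refine perm_lt_of_forall_not_descent π hij fun k hk h1 h2 hdesc => ?_
    have := (h.2 k hk).1 hdesc
    omega

theorem HasOnlyDescent.not_monotone {n : ℕ} {π : Equiv.Perm (Fin n)} {d : ℕ}
    (h : HasOnlyDescent π d) {χ : Fin n → Bool} (hπ : π = Tuple.sort χ) : ¬ Monotone χ := by
  rw [← Tuple.sort_eq_refl_iff_monotone, ← hπ]
  rintro rfl
  simpa using (h.2 d h.1).2 rfl

theorem HasOnlyDescent.apply_eq {n : ℕ} {χ : Fin n → Bool} {d : ℕ}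
    (h : HasOnlyDescent (Tuple.sort χ) d) (v : Fin n) :
    χ v = decide (d < ((Tuple.sort χ).symm v : ℕ)) := by
  simpa using apply_sort_eq_of_descent χ h.1 ((h.2 d h.1).2 rfl) ((Tuple.sort χ).symm v)

theorem eulerianNum_one_eq_card_not_monotone (n : ℕ) :
    eulerianNum n 1 = #{χ : Fin n → Bool | ¬ Monotone χ} := by
  symm
  refine card_bij (fun χ _ => Tuple.sort χ) ?_ ?_ ?_
  · intro χ hχ
    simp only [mem_filter, mem_univ, true_and] at hχ ⊢
    exact (descentCount_eq_one_iff _).2 (exists_hasOnlyDescent_sort hχ)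
  · intro χ hχ ψ hψ he
    simp only [mem_filter, mem_univ, true_and] at hχ hψ
    obtain ⟨d, hd⟩ := exists_hasOnlyDescent_sort hχ
    obtain ⟨e, hd'⟩ := exists_hasOnlyDescent_sort hψ
    have hde : d = e := ((he ▸ hd').2 d hd.1).1 ((hd.2 d hd.1).2 rfl)
    funext v
    rw [hd.apply_eq, hd'.apply_eq, he, hde]
  · intro π hπ
    simp only [mem_filter, mem_univ, true_and, descentCount_eq_one_iff] at hπ
    obtain ⟨d, hd⟩ := hπ
    exact ⟨_, by simpa using hd.not_monotone hd.eq_sort, hd.eq_sort.symm⟩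

theorem card_monotone_bool (n : ℕ) : #{χ : Fin n → Bool | Monotone χ} = n + 1 := by
  rw [← card_range (n + 1)]
  symm
  refine card_bij (fun k _ i => decide (k ≤ (i : ℕ))) ?_ ?_ ?_
  · intro k _
    simp only [mem_filter, mem_univ, true_and]
    intro i j hij
    rw [Bool.le_iff_imp]
    simp only [decide_eq_true_eq]
    exact fun hk => hk.trans hij
  · intro k hk l hl he
    simp only [mem_range] at hk hl
    by_contra hne
    rcases lt_or_gt_of_ne hne with h | h
    · have := congrFun he ⟨k, by omega⟩
      simp at this
      omega
    · have := congrFun he ⟨l, by omega⟩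
      simp at this
      omega
  · intro χ hχ
    simp only [mem_filter, mem_univ, true_and] at hχ
    have hex : ∃ k, ∀ i : Fin n, k ≤ (i : ℕ) → χ i = true := ⟨n, fun i hi => by omega⟩
    refine ⟨Nat.find hex, ?_, ?_⟩
    · have := Nat.find_min' hex (m := n) fun i hi => by omega
      simp only [mem_range]
      omega
    · funext i
      by_cases hi : Nat.find hex ≤ (i : ℕ)
      · simp only [hi, decide_true, Nat.find_spec hex i hi]
      · simp only [hi, decide_false]
        have hmin := Nat.find_min hex (not_le.1 hi)
        by_contra hne
        refine hmin fun j hij => ?_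
        have hle : χ i ≤ χ j := hχ hij
        rw [Bool.eq_true_of_not_eq_false (Ne.symm hne)] at hle
        exact Bool.eq_true_of_true_le hle

theorem eulerianNum_one_add (n : ℕ) : eulerianNum n 1 + (n + 1) = 2 ^ n := by
  rw [eulerianNum_one_eq_card_not_monotone, ← card_monotone_bool n, add_comm,
    card_filter_add_card_filter_not]
  simp

theorem hasOnlyDescent_sort_ne {n : ℕ} (hn : 0 < n) {v : Fin n} (hv : v ≠ ⟨0, hn⟩) :
    HasOnlyDescent (Tuple.sort fun u => decide (u ≠ v)) 0 ∧
      (Tuple.sort fun u => decide (u ≠ v)) ⟨0, hn⟩ = v := by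
  have hmono : ¬ Monotone fun u => decide (u ≠ v) := fun h => by
    have := h (Fin.le_def.2 (Nat.zero_le v) : (⟨0, hn⟩ : Fin n) ≤ v)
    simp only [ne_eq, hv.symm, not_false_eq_true, decide_true, not_true, decide_false] at this
    exact absurd (Bool.eq_true_of_true_le this) Bool.false_ne_true
  obtain ⟨d, hd⟩ := exists_hasOnlyDescent_sort hmono
  have happ : ∀ i : ℕ, ∀ hi : i < n, i ≤ d →
      (Tuple.sort fun u => decide (u ≠ v)) ⟨i, hi⟩ = v := by
    intro i hi hid
    have := hd.apply_eq ((Tuple.sort fun u => decide (u ≠ v)) ⟨i, hi⟩)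
    rw [Equiv.symm_apply_apply, decide_eq_decide] at this
    by_contra hne
    exact absurd (this.1 hne) (not_lt.2 hid)
  have hd1 := hd.1
  have hd0 : d = 0 := by
    have := (Tuple.sort fun u => decide (u ≠ v)).injective
      ((happ 0 hn (Nat.zero_le d)).trans (happ d (by omega) le_rfl).symm)
    simpa using this.symm
  exact ⟨hd0 ▸ hd, happ 0 hn (Nat.zero_le d)⟩

theorem card_hasOnlyDescent_zero {n : ℕ} (hn : 0 < n) :
    #{π : Equiv.Perm (Fin n) | HasOnlyDescent π 0} = n - 1 := by
  have hcard : #((univ : Finset (Fin n)).erase ⟨0, hn⟩) = n - 1 := by simp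
  rw [← hcard]
  symm
  refine card_bij (fun v _ => Tuple.sort fun u => decide (u ≠ v)) ?_ ?_ ?_
  · intro v hv
    simpa using (hasOnlyDescent_sort_ne hn (ne_of_mem_erase hv)).1
  · intro v hv w hw he
    rw [← (hasOnlyDescent_sort_ne hn (ne_of_mem_erase hv)).2,
      ← (hasOnlyDescent_sort_ne hn (ne_of_mem_erase hw)).2]
    exact congrArg (fun σ : Equiv.Perm (Fin n) => σ ⟨0, hn⟩) he
  · intro π hπ
    simp only [mem_filter, mem_univ, true_and] at hπ
    have hfun : (fun v => decide (0 < (π.symm v : ℕ))) = fun u => decide (u ≠ π ⟨0, hn⟩) := by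
      funext v
      rw [decide_eq_decide, Ne, ← Equiv.symm_apply_eq, Fin.ext_iff]
      simp [Nat.pos_iff_ne_zero]
    have hsort := hfun ▸ hπ.eq_sort
    refine ⟨π ⟨0, hn⟩, mem_erase.2 ⟨fun h0 => ?_, mem_univ _⟩, hsort.symm⟩
    have hdesc := (hπ.2 0 hπ.1).2 rfl
    rw [h0] at hdesc
    exact absurd hdesc (by simp [Fin.lt_def])

theorem HasOnlyDescent.isBallot_iff {n : ℕ} {π : Equiv.Perm (Fin n)} {d : ℕ}
    (h : HasOnlyDescent π d) : IsBallot π ↔ d ≠ 0 := by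
  have hset := (descentSet_permWord_eq_singleton_iff π d).2 h
  have hd := h.1
  have hgetD : ∀ k i, i < k → ((permWord π).take k).getD i 0 = (permWord π).getD i 0 := by
    intro k i hi
    simp [List.getD_eq_getElem?_getD, hi]
  have htake : ∀ k, k ≤ n → descentSet ((permWord π).take k) =
      ({d} : Finset ℕ).filter (· < k - 1) := by
    intro k hk
    ext i
    rw [← hset]
    simp only [descentSet, mem_filter, mem_range, List.length_take, length_permWord]
    constructor
    · rintro ⟨h1, h2⟩
      rw [hgetD k _ (by omega), hgetD k _ (by omega)] at h2
      exact ⟨⟨by omega, h2⟩, by omega⟩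
    · rintro ⟨⟨h1, h2⟩, h3⟩
      rw [hgetD k _ (by omega), hgetD k _ (by omega)]
      exact ⟨by omega, h2⟩
  constructor
  · rintro hb rfl
    have h2 := hb 2 (by omega)
    rw [htake 2 (by omega)] at h2
    have hasc : ascentSet ((permWord π).take 2) = ∅ := by
      refine filter_eq_empty_iff.2 fun i hi => ?_
      simp only [mem_range, List.length_take, length_permWord] at hi
      obtain rfl : i = 0 := by omega
      rw [hgetD 2 _ (by omega), hgetD 2 _ (by omega)]
      have : 0 ∈ descentSet (permWord π) := by simp [hset]
      exact (mem_filter.1 this).2.not_gt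
    simp [hasc, filter_singleton] at h2
  · intro hd0 k hk
    rw [htake k hk, filter_singleton]
    split_ifs with hdk
    · rw [card_singleton, Nat.one_le_iff_ne_zero, Ne, card_eq_zero, ← Ne, ← nonempty_iff_ne_empty]
      refine ⟨0, ?_⟩
      simp only [ascentSet, mem_filter, mem_range, List.length_take, length_permWord]
      refine ⟨by omega, ?_⟩
      rw [hgetD k _ (by omega), hgetD k _ (by omega), permWord_getD π (by omega : 0 < n),
        permWord_getD π (by omega : 0 + 1 < n)]
      have := perm_lt_of_forall_not_descent π (i := ⟨0, by omega⟩) (j := ⟨0 + 1, by omega⟩)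
        (by simp) fun i hi _ h2 hdesc => by
          have := (h.2 i hi).1 hdesc
          simp at h2
          omega
      simpa using this
    · simp

theorem bCount_one_add {n : ℕ} (hn : 0 < n) : bCount n 1 + (n - 1) = eulerianNum n 1 := by
  rw [← card_hasOnlyDescent_zero hn, bCount, eulerianNum, ← card_union_of_disjoint]
  · congr 1
    ext π
    simp only [mem_union, mem_filter, mem_univ, true_and, descentCount_eq_one_iff]
    constructor
    · rintro (⟨-, h⟩ | h)
      exacts [h, ⟨0, h⟩]
    · rintro ⟨d, h⟩
      by_cases hd : d = 0
      · exact Or.inr (hd ▸ h)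
      · exact Or.inl ⟨h.isBallot_iff.2 hd, d, h⟩
  · rw [disjoint_left]
    intro π h1 h2
    simp only [mem_filter, mem_univ, true_and] at h1 h2
    exact h2.isBallot_iff.1 h1.1 rfl

theorem le_of_unique_descent {n : ℕ} {c : Equiv.Perm (Fin n)} {m : Fin n}
    (h : ∀ x, c x < x ↔ x = m) {x : Fin n} (hx : x ∈ c.support) : x ≤ m := by
  have hmax := c.support.max'_mem ⟨x, hx⟩
  have hlt : c (c.support.max' ⟨x, hx⟩) < c.support.max' ⟨x, hx⟩ :=
    lt_of_le_of_ne (c.support.le_max' _ (Equiv.Perm.apply_mem_support.2 hmax))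
      (Equiv.Perm.mem_support.1 hmax)
  exact (h _).1 hlt ▸ c.support.le_max' _ hx

theorem mem_support_of_unique_descent {n : ℕ} {c : Equiv.Perm (Fin n)} {m : Fin n}
    (h : ∀ x, c x < x ↔ x = m) : m ∈ c.support :=
  Equiv.Perm.mem_support.2 ((h m).2 rfl).ne

theorem not_between_of_unique_descent {n : ℕ} {c : Equiv.Perm (Fin n)} {m : Fin n}
    (h : ∀ x, c x < x ↔ x = m) {x y : Fin n} (hy : y ∈ c.support) (hxy : x < y) :
    ¬ y < c x := by
  intro hyc
  have hxm : x ≠ m := fun he => ((h x).2 he).not_gt (hxy.trans hyc)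
  set A := c.support.filter (y ≤ ·) with hA
  have hmA : m ∈ A :=
    mem_filter.2 ⟨mem_support_of_unique_descent h, le_of_unique_descent h hy⟩
  have hyA : y ∈ A := mem_filter.2 ⟨hy, le_rfl⟩
  have hxA : x ∉ A.erase m := fun hx =>
    hxy.not_ge (mem_filter.1 (mem_of_mem_erase hx)).2
  have hle : #(insert x (A.erase m)) ≤ #(A.erase y) := by
    refine card_le_card_of_injOn c (fun z hz => ?_) c.injective.injOn
    rw [coe_insert, Set.mem_insert_iff, mem_coe] at hz
    have key : y < c z ∧ z ∈ c.support := by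
      rcases hz with rfl | hz
      · exact ⟨hyc, Equiv.Perm.mem_support.2 (hxy.trans hyc).ne'⟩
      · obtain ⟨hzm, hz⟩ := mem_erase.1 hz
        obtain ⟨hzs, hyz⟩ := mem_filter.1 hz
        refine ⟨lt_of_le_of_lt hyz (lt_of_le_of_ne (not_lt.1 fun hlt => hzm ((h z).1 hlt)) ?_), hzs⟩
        exact (Equiv.Perm.mem_support.1 hzs).symm
    exact mem_erase.2 ⟨key.1.ne', mem_filter.2
      ⟨Equiv.Perm.apply_mem_support.2 key.2, key.1.le⟩⟩
  rw [card_insert_of_notMem hxA, card_erase_of_mem hmA, card_erase_of_mem hyA] at hle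
  have := card_pos.2 ⟨y, hyA⟩
  omega

theorem eq_of_support_eq_of_unique_descent {n : ℕ} {c c' : Equiv.Perm (Fin n)} {m m' : Fin n}
    (h : ∀ x, c x < x ↔ x = m) (h' : ∀ x, c' x < x ↔ x = m') (hs : c.support = c'.support) :
    c = c' := by
  have hm : m = m' := le_antisymm
    (le_of_unique_descent h' (hs ▸ mem_support_of_unique_descent h))
    (le_of_unique_descent h (hs ▸ mem_support_of_unique_descent h'))
  subst hm
  have happ : ∀ {a b : Equiv.Perm (Fin n)}, (∀ x, a x < x ↔ x = m) → (∀ x, b x < x ↔ x = m) →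
      a.support = b.support → ∀ x ≠ m, ¬ a x < b x := by
    intro a b ha hb hab x hx hlt
    have hxs : x ∈ a.support := by
      rw [hab, Equiv.Perm.mem_support]
      intro hbx
      exact hx ((ha x).1 (hlt.trans_eq hbx))
    have hxa : x < a x := lt_of_le_of_ne (not_lt.1 fun hl => hx ((ha x).1 hl))
      (Equiv.Perm.mem_support.1 hxs).symm
    exact not_between_of_unique_descent hb (hab ▸ Equiv.Perm.apply_mem_support.2 hxs) hxa hlt
  have hne : ∀ x ≠ m, c x = c' x := fun x hx =>
    le_antisymm (not_lt.1 (happ h' h hs.symm x hx)) (not_lt.1 (happ h h' hs x hx))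
  refine Equiv.ext fun x => ?_
  by_cases hx : x = m
  · obtain ⟨y, hy⟩ := c'.surjective (c x)
    by_cases hym : y = m
    · rw [← hy, hx, hym]
    · rw [← hne y hym] at hy
      exact absurd ((c.injective hy).trans hx) hym
  · exact hne x hx

theorem card_descents_eq_one_iff {n : ℕ} (c : Equiv.Perm (Fin n)) :
    #{x ∈ c.support | c x < x} = 1 ↔ ∃ m, ∀ x, c x < x ↔ x = m := by
  have hmem : ∀ x, (c x ≠ x ∧ c x < x) ↔ c x < x := fun x => and_iff_right_of_imp fun h => h.ne
  simp only [card_eq_one, Finset.ext_iff, mem_filter, Equiv.Perm.mem_support, mem_singleton, hmem]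

theorem exists_isCycle_unique_descent {n : ℕ} {S : Finset (Fin n)} (hS : 2 ≤ #S) :
    ∃ c : Equiv.Perm (Fin n), c.IsCycle ∧ c.support = S ∧ ∃ m, ∀ x, c x < x ↔ x = m := by
  have hlen : S.sort.length = #S := S.length_sort (· ≤ ·)
  have hnodup : S.sort.Nodup := S.sort_nodup (· ≤ ·)
  have hmono : ∀ i j (hi : i < S.sort.length) (hj : j < S.sort.length),
      i < j → S.sort[i] < S.sort[j] := fun i j hi hj hij =>
    List.pairwise_iff_getElem.1 S.sortedLT_sort.pairwise i j hi hj hij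
  refine ⟨S.sort.formPerm, List.isCycle_formPerm hnodup (by omega), ?_,
    S.sort[#S - 1], fun x => ?_⟩
  · rw [List.support_formPerm_of_nodup _ hnodup, sort_toFinset]
    intro x hx
    rw [hx] at hlen
    simp at hlen
    omega
  · by_cases hx : x ∈ S.sort
    · obtain ⟨i, hi, rfl⟩ := List.getElem_of_mem hx
      rw [List.formPerm_apply_getElem _ hnodup, hnodup.getElem_inj_iff]
      by_cases hi' : i + 1 < S.sort.length
      · simp only [Nat.mod_eq_of_lt hi']
        exact iff_of_false (hmono i (i + 1) hi hi' (Nat.lt_succ_self i)).not_gt (by omega)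
      · have hi1 : i + 1 = S.sort.length := by omega
        simp only [hi1, Nat.mod_self]
        exact iff_of_true (hmono 0 i (by omega) hi (by omega)) (by omega)
    · rw [List.formPerm_apply_of_notMem hx]
      exact iff_of_false (lt_irrefl x) fun he => hx (he ▸ List.getElem_mem _)

theorem card_odd_order_cycles_one_descent (n : ℕ) :
    #{c : Equiv.Perm (Fin n) | c.IsCycle ∧ Odd (orderOf c) ∧ #{x ∈ c.support | c x < x} = 1} =
      #{S : Finset (Fin n) | Odd #S ∧ #S ≠ 1} := by
  refine card_bij (fun c _ => c.support) ?_ ?_ ?_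
  · intro c hc
    simp only [mem_filter, mem_univ, true_and] at hc ⊢
    exact ⟨hc.1.orderOf ▸ hc.2.1, Equiv.Perm.card_support_ne_one c⟩
  · intro c hc c' hc' hs
    simp only [mem_filter, mem_univ, true_and, card_descents_eq_one_iff] at hc hc'
    obtain ⟨m, hm⟩ := hc.2.2
    obtain ⟨m', hm'⟩ := hc'.2.2
    exact eq_of_support_eq_of_unique_descent hm hm' hs
  · intro S hS
    simp only [mem_filter, mem_univ, true_and] at hS
    obtain ⟨c, hc, hcS, hm⟩ := exists_isCycle_unique_descent (S := S)
      (by have := hS.1.pos; have := hS.2; omega)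
    refine ⟨c, ?_, hcS⟩
    simp only [mem_filter, mem_univ, true_and, card_descents_eq_one_iff]
    exact ⟨hc, by rw [hc.orderOf, hcS]; exact hS.1, hm⟩

theorem card_odd_subsets {n : ℕ} (hn : 0 < n) :
    #{S : Finset (Fin n) | Odd #S} = 2 ^ (n - 1) := by
  have hne : (univ : Finset (Fin n)).Nonempty := ⟨⟨0, hn⟩, mem_univ _⟩
  have hsum := sum_powerset_neg_one_pow_card_of_nonempty hne
  rw [powerset_univ, ← sum_filter_add_sum_filter_not univ fun S : Finset (Fin n) => Odd #S,
    sum_congr rfl (g := fun _ => -1) fun S hS => (mem_filter.1 hS).2.neg_one_pow,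
    sum_congr (s₁ := univ.filter fun S : Finset (Fin n) => ¬ Odd #S) rfl (g := fun _ => 1)
      fun S hS => (Nat.not_odd_iff_even.1 (mem_filter.1 hS).2).neg_one_pow] at hsum
  have htot := card_filter_add_card_filter_not (s := univ) fun S : Finset (Fin n) => Odd #S
  simp only [sum_const, card_univ, Fintype.card_finset, Fintype.card_fin, nsmul_eq_mul]
    at hsum htot
  have hpow : 2 ^ n = 2 * 2 ^ (n - 1) := by
    rw [← pow_succ', Nat.sub_add_cancel hn]
  omega

theorem card_odd_subsets_ne_one_add {n : ℕ} (hn : 0 < n) :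
    #{S : Finset (Fin n) | Odd #S ∧ #S ≠ 1} + n = 2 ^ (n - 1) := by
  have hone : #{S : Finset (Fin n) | Odd #S ∧ #S = 1} = n := by
    have : ({S : Finset (Fin n) | Odd #S ∧ #S = 1} : Finset _) = powersetCard 1 univ := by
      ext S
      simp only [mem_filter, mem_univ, true_and, mem_powersetCard, subset_univ]
      exact ⟨fun h => h.2, fun h => ⟨h ▸ odd_one, h⟩⟩
    rw [this, card_powersetCard]
    simp
  have hsplit := card_filter_add_card_filter_not
    (s := univ.filter fun S : Finset (Fin n) => Odd #S) fun S => #S = 1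
  rw [filter_filter, filter_filter, card_odd_subsets hn, hone] at hsplit
  rw [add_comm]
  exact hsplit

theorem Equiv.Perm.IsCycle.card_descents_pos {n : ℕ} {c : Equiv.Perm (Fin n)} (hc : c.IsCycle) :
    0 < #{x ∈ c.support | c x < x} := by
  obtain ⟨y, hy⟩ := hc.nonempty_support
  have hmax := c.support.max'_mem ⟨y, hy⟩
  refine card_pos.2 ⟨_, mem_filter.2 ⟨hmax, lt_of_le_of_ne
    (c.support.le_max' _ (Equiv.Perm.apply_mem_support.2 hmax)) (Equiv.Perm.mem_support.1 hmax)⟩⟩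

theorem card_descents_inv {n : ℕ} (c : Equiv.Perm (Fin n)) :
    #{x ∈ (c⁻¹).support | c⁻¹ x < x} = #{x ∈ c.support | x < c x} := by
  symm
  refine card_bij (fun x _ => c x) ?_ (fun x _ y _ h => c.injective h) ?_
  · intro x hx
    simpa [eq_comm] using hx
  · intro x hx
    have hlt := (mem_filter.1 hx).2
    refine ⟨c.symm x, mem_filter.2 ⟨?_, ?_⟩, c.apply_symm_apply x⟩
    · rw [Equiv.Perm.mem_support, Equiv.apply_symm_apply]
      exact hlt.ne'
    · rwa [Equiv.apply_symm_apply]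

theorem Equiv.Perm.IsCycle.cycleM_pos {n : ℕ} {c : Equiv.Perm (Fin n)} (hc : c.IsCycle) :
    0 < cycleM c :=
  lt_min (card_descents_inv c ▸ hc.inv.card_descents_pos) hc.card_descents_pos

theorem permM_eq_one_iff {n : ℕ} (π : Equiv.Perm (Fin n)) :
    permM π = 1 ↔ π.IsCycle ∧ cycleM π = 1 := by
  constructor
  · intro h
    have hpos : ∀ c ∈ π.cycleFactorsFinset, 1 ≤ cycleM c := fun c hc =>
      (Equiv.Perm.mem_cycleFactorsFinset_iff.1 hc).1.cycleM_pos
    have hle : #π.cycleFactorsFinset ≤ 1 := by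
      rw [← h, permM, card_eq_sum_ones]
      exact sum_le_sum hpos
    have hne : #π.cycleFactorsFinset ≠ 0 := fun h0 => by
      rw [permM, card_eq_zero.1 h0, sum_empty] at h
      exact zero_ne_one h
    obtain ⟨c, hc⟩ := card_eq_one.1 (by omega : #π.cycleFactorsFinset = 1)
    obtain ⟨hcyc, rfl⟩ := Equiv.Perm.cycleFactorsFinset_eq_singleton_iff.1 hc
    rw [permM, hc, sum_singleton] at h
    exact ⟨hcyc, h⟩
  · rintro ⟨hc, h⟩
    rw [permM, hc.cycleFactorsFinset_eq_singleton, sum_singleton, h]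

theorem pCount_one (n : ℕ) : pCount n 1 = 2 * #{S : Finset (Fin n) | Odd #S ∧ #S ≠ 1} := by
  rw [← card_odd_order_cycles_one_descent, two_mul]
  set A : Finset (Equiv.Perm (Fin n)) :=
    {c | c.IsCycle ∧ Odd (orderOf c) ∧ #{x ∈ c.support | c x < x} = 1} with hA
  have hmemA : ∀ c, c ∈ A ↔ c.IsCycle ∧ Odd (orderOf c) ∧ #{x ∈ c.support | c x < x} = 1 := by
    simp [hA]
  have hmemInv : ∀ c, c ∈ A.map (Equiv.inv _).toEmbedding ↔
      c.IsCycle ∧ Odd (orderOf c) ∧ #{x ∈ c.support | x < c x} = 1 := by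
    intro c
    rw [mem_map_equiv, Equiv.inv_symm, Equiv.inv_apply, hmemA, Equiv.Perm.isCycle_inv, orderOf_inv,
      card_descents_inv]
  have hdisj : Disjoint A (A.map (Equiv.inv _).toEmbedding) := by
    rw [disjoint_left]
    intro c h1 h2
    rw [hmemA] at h1
    rw [hmemInv] at h2
    have hsplit := card_filter_add_card_filter_not (s := c.support) fun x => c x < x
    have hasc : ({x ∈ c.support | ¬ c x < x} : Finset _) = {x ∈ c.support | x < c x} :=
      filter_congr fun x hx => ⟨fun h => lt_of_le_of_ne (not_lt.1 h)
        (Equiv.Perm.mem_support.1 hx).symm, fun h => h.not_gt⟩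
    rw [hasc, h1.2.2, h2.2.2, ← h1.1.orderOf] at hsplit
    have := h1.2.1
    rw [← hsplit] at this
    exact absurd this (by decide)
  rw [← card_map (s := A) (Equiv.inv _).toEmbedding]
  nth_rewrite 1 [card_map]
  rw [← card_union_of_disjoint hdisj, pCount]
  congr 1
  ext c
  rw [mem_union, hmemA, hmemInv, mem_filter, permM_eq_one_iff]
  simp only [mem_univ, true_and]
  constructor
  · rintro ⟨ho, hc, h⟩
    rcases min_choice #{x ∈ c.support | x < c x} #{x ∈ c.support | c x < x} with hm | hm
    · exact Or.inr ⟨hc, ho, hm.symm.trans h⟩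
    · exact Or.inl ⟨hc, ho, hm.symm.trans h⟩
  · have hpos := fun hc : c.IsCycle => hc.cycleM_pos
    rintro (⟨hc, ho, h⟩ | ⟨hc, ho, h⟩)
    · exact ⟨ho, hc, le_antisymm ((min_le_right _ _).trans h.le) (hpos hc)⟩
    · exact ⟨ho, hc, le_antisymm ((min_le_left _ _).trans h.le) (hpos hc)⟩

theorem ballot_eq_odd_order_one_descent (n : ℕ) (hn : 1 ≤ n) :
    bCount n 1 = pCount n 1 ∧ bCount n 1 = 2 * eulerianNum (n - 1) 1 ∧
      eulerianNum (n - 1) 1 = 2 ^ (n - 1) - (n - 1) - 1 := by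
  have hpow : 2 ^ n = 2 * 2 ^ (n - 1) := by
    rw [← pow_succ', Nat.sub_add_cancel hn]
  have hE := eulerianNum_one_add (n - 1)
  have hE' := eulerianNum_one_add n
  have hb := bCount_one_add hn
  have hp := pCount_one n
  have hS := card_odd_subsets_ne_one_add hn
  omega
end
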